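/- (Fisk, quoted and used as Proposition 1.) Let (X_n)_{n∈ℕ} be a nonnegative, integrable stochastic process adapted to a filtration (𝓕_n)_{n∈ℕ} on a probability space. Assume the positive variations are summable in expectation: Σ_{n=0}^∞ E[(E[X_{n+1} − X_n | 𝓕_n])⁺] < ∞, where x⁺ = max(x,0). Then (X_n) is a quasi-martingale: almost surely Σ_{n=0}^∞ |E[X_{n+1} − X_n | 𝓕_n]| < ∞, and X_n converges almost surely to a finite limit. -/

import Mathlib

open MeasureTheory Filter Topology

section

variable {Ω : Type*} {m0 : MeasurableSpace Ω} {μ : Measure Ω}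

lemma eLpNorm_one_eq_ofReal_integral_norm {f : Ω → ℝ} (hf : Integrable f μ) :
    eLpNorm f 1 μ = ENNReal.ofReal (∫ ω, ‖f ω‖ ∂μ) := by
  rw [eLpNorm_one_eq_lintegral_enorm, ofReal_integral_norm_eq_lintegral_enorm hf]

/-- If the `L¹` norms of a sequence are summable, the sequence is almost surely absolutely
summable. -/
lemma ae_summable_norm_of_summable_integral_norm {f : ℕ → Ω → ℝ}
    (hf : ∀ n, Integrable (f n) μ) (hsum : Summable fun n => ∫ ω, ‖f n ω‖ ∂μ) :
    ∀ᵐ ω ∂μ, Summable fun n => ‖f n ω‖ := by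
  refine summable_norm_of_tsum_eLpNorm_ne_top le_rfl (fun n => (hf n).1) ?_
  simp_rw [fun n => eLpNorm_one_eq_ofReal_integral_norm (hf n)]
  exact hsum.tsum_ofReal_ne_top

variable [IsFiniteMeasure μ] {ℱ : Filtration ℕ m0} {X : ℕ → Ω → ℝ}

lemma sum_integral_condExp_sub (hX_int : ∀ n, Integrable (X n) μ) (N : ℕ) :
    ∑ n ∈ Finset.range N, ∫ ω, (μ[X (n + 1) - X n | ℱ n]) ω ∂μ
      = ∫ ω, X N ω ∂μ - ∫ ω, X 0 ω ∂μ := by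
  rw [← Finset.sum_range_sub (fun n => ∫ ω, X n ω ∂μ) N]
  refine Finset.sum_congr rfl fun n _ => ?_
  rw [integral_condExp (ℱ.le n), ← integral_sub (hX_int _) (hX_int _)]
  rfl

/-- For a nonnegative process, summability in expectation of the positive parts of the conditional
increments upgrades to summability in expectation of their absolute values. -/
lemma summable_integral_norm_condExp_sub (hX_nonneg : ∀ n ω, 0 ≤ X n ω)
    (hX_int : ∀ n, Integrable (X n) μ)
    (hsum : Summable fun n => ∫ ω, max ((μ[X (n + 1) - X n | ℱ n]) ω) 0 ∂μ) :
    Summable fun n => ∫ ω, ‖(μ[X (n + 1) - X n | ℱ n]) ω‖ ∂μ := by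
  have hnorm (n : ℕ) : ∫ ω, ‖(μ[X (n + 1) - X n | ℱ n]) ω‖ ∂μ
      = 2 * ∫ ω, max ((μ[X (n + 1) - X n | ℱ n]) ω) 0 ∂μ
        - ∫ ω, (μ[X (n + 1) - X n | ℱ n]) ω ∂μ := by
    rw [← integral_const_mul,
      ← integral_sub (integrable_condExp.pos_part.const_mul 2) integrable_condExp]
    congr with ω
    rw [Real.norm_eq_abs]
    grind
  refine summable_of_sum_range_le
    (c := 2 * ∑' n, ∫ ω, max ((μ[X (n + 1) - X n | ℱ n]) ω) 0 ∂μ + ∫ ω, X 0 ω ∂μ)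
    (fun n => integral_nonneg fun ω => norm_nonneg _) fun N => ?_
  rw [Finset.sum_congr rfl fun n _ => hnorm n, Finset.sum_sub_distrib, ← Finset.mul_sum,
    sum_integral_condExp_sub hX_int]
  have hle := hsum.sum_le_tsum (Finset.range N)
    fun n _ => integral_nonneg fun ω => le_max_right _ _
  have hN : 0 ≤ ∫ ω, X N ω ∂μ := integral_nonneg (hX_nonneg N)
  linarith

/-- The martingale part of a nonnegative process whose conditional increments are summable in `L¹`
is bounded in `L¹`. -/
lemma integral_norm_martingalePart_le (hX_nonneg : ∀ n ω, 0 ≤ X n ω)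
    (hX_int : ∀ n, Integrable (X n) μ)
    (hsum : Summable fun n => ∫ ω, ‖(μ[X (n + 1) - X n | ℱ n]) ω‖ ∂μ) (N : ℕ) :
    ∫ ω, ‖martingalePart X ℱ μ N ω‖ ∂μ
      ≤ ∫ ω, X 0 ω ∂μ + 2 * ∑' n, ∫ ω, ‖(μ[X (n + 1) - X n | ℱ n]) ω‖ ∂μ := by
  have hle := hsum.sum_le_tsum (Finset.range N)
    fun n _ => integral_nonneg fun ω => norm_nonneg _
  have hX : ∫ ω, X N ω ∂μ - ∫ ω, X 0 ω ∂μ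
      ≤ ∑ n ∈ Finset.range N, ∫ ω, ‖(μ[X (n + 1) - X n | ℱ n]) ω‖ ∂μ := by
    rw [← sum_integral_condExp_sub hX_int]
    exact Finset.sum_le_sum fun n _ =>
      (Real.le_norm_self _).trans (norm_integral_le_integral_norm _)
  have hint : Integrable
      (fun ω => ∑ n ∈ Finset.range N, ‖(μ[X (n + 1) - X n | ℱ n]) ω‖) μ :=
    integrable_finsetSum _ fun n _ => integrable_condExp.norm
  have hM : ∫ ω, ‖martingalePart X ℱ μ N ω‖ ∂μ ≤ ∫ ω, X N ω ∂μ
      + ∑ n ∈ Finset.range N, ∫ ω, ‖(μ[X (n + 1) - X n | ℱ n]) ω‖ ∂μ := by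
    rw [← integral_finsetSum _ fun n _ => integrable_condExp.norm, ← integral_add (hX_int N) hint]
    refine integral_mono (integrable_martingalePart hX_int N).norm ((hX_int N).add hint)
      fun ω => ?_
    simp only [martingalePart, predictablePart, Pi.sub_apply, Finset.sum_apply]
    refine (norm_sub_le _ _).trans (add_le_add ?_ (norm_sum_le _ _))
    rw [Real.norm_of_nonneg (hX_nonneg N ω)]
  linarith

end

/-- Fisk's theorem (Proposition 1): a nonnegative, integrable, adapted process whose
positive variations are summable in expectation is a quasi-martingale: almost surely the
conditional increments are absolutely summable and the process converges to a finite
limit. -/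
theorem fisk_quasimartingale {Ω : Type*} {m0 : MeasurableSpace Ω} {μ : Measure Ω}
    [IsProbabilityMeasure μ] (ℱ : Filtration ℕ m0) (X : ℕ → Ω → ℝ)
    (hX_nonneg : ∀ n ω, 0 ≤ X n ω)
    (hX_int : ∀ n, Integrable (X n) μ)
    (hX_adapted : Adapted ℱ X)
    (hsum : Summable fun n => ∫ ω, max ((μ[X (n + 1) - X n | ℱ n]) ω) 0 ∂μ) :
    ∀ᵐ ω ∂μ,
      (Summable fun n => |(μ[X (n + 1) - X n | ℱ n]) ω|) ∧
        ∃ l : ℝ, Tendsto (fun n => X n ω) atTop (𝓝 l) := by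
  have hnorm := summable_integral_norm_condExp_sub hX_nonneg hX_int hsum
  have hmart : Martingale (martingalePart X ℱ μ) ℱ μ :=
    martingale_martingalePart hX_adapted.stronglyAdapted hX_int
  have hconv := hmart.submartingale.exists_ae_tendsto_of_bdd
    (R := (∫ ω, X 0 ω ∂μ + 2 * ∑' n, ∫ ω, ‖(μ[X (n + 1) - X n | ℱ n]) ω‖ ∂μ).toNNReal)
    fun n => by
      rw [eLpNorm_one_eq_ofReal_integral_norm (hmart.integrable n)]
      exact ENNReal.ofReal_le_ofReal (integral_norm_martingalePart_le hX_nonneg hX_int hnorm n)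
  filter_upwards [ae_summable_norm_of_summable_integral_norm (fun _ => integrable_condExp) hnorm,
    hconv] with ω hω ⟨c, hc⟩
  refine ⟨hω, _, (hc.add hω.of_norm.hasSum.tendsto_sum_nat).congr fun n => ?_⟩
  simp [martingalePart, predictablePart]
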